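/- arXiv:2103.10471 — 2 statements merged into one kernel-verified Lean document; each statement's English description precedes it below -/
import Mathlib

section
/- Let α ∈ (0,1) and let f be a pmf on ℕ with finite mean μ^{(f)} and finite variance (σ^{(f)})², with pgf Ψ, and let p be the pmf with pgf φ(z) = ∏_{i=0}^∞ Ψ(1 − α^i + α^i z), with mean μ^{(p)} and variance (σ^{(p)})². Then p is underdispersed if and only if f is underdispersed; that is, (σ^{(p)})² < μ^{(p)} if and only if (σ^{(f)})² < μ^{(f)}. -/
open Filter Topology in
lemma pgf_expand (g : ℕ → ℝ) (hg0 : ∀ k, 0 ≤ g k) (hg1 : HasSum g 1)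
    (h1 : Summable fun k : ℕ => (k : ℝ) * g k)
    (h2 : Summable fun k : ℕ => (k : ℝ) ^ 2 * g k) :
    ∃ R : ℝ → ℝ, Tendsto R (𝓝[>] 0)
        (𝓝 (((∑' k : ℕ, (k : ℝ) ^ 2 * g k) - ∑' k : ℕ, (k : ℝ) * g k) / 2)) ∧
      ∀ t ∈ Set.Icc (0 : ℝ) 1, 0 ≤ R t ∧ R t ≤ (∑' k : ℕ, (k : ℝ) ^ 2 * g k) ∧
        ∑' k : ℕ, g k * (1 - t) ^ k = 1 - (∑' k : ℕ, (k : ℝ) * g k) * t + R t * t ^ 2 := by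
  let e : ℕ → ℝ → ℝ := fun k t => Nat.rec (motive := fun _ => ℝ) 0 (fun n x => (1 - t) * x + n) k
  have es : ∀ k t, e (k+1) t = (1 - t) * e k t + k := fun k t => rfl
  have e0 : ∀ t, e 0 t = 0 := fun t => rfl
  have ec : ∀ k, Continuous (e k) := by
    intro k
    induction k with
    | zero => exact continuous_const
    | succ k ih =>
      have : e (k+1) = fun t => (1 - t) * e k t + k := rfl
      rw [this]; fun_prop
  have ev : ∀ k, e k 0 = ((k:ℝ)^2 - k) / 2 := by
    intro k
    induction k with
    | zero => simp [e0]
    | succ k ih => rw [es, ih]; push_cast; ring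
  have ep : ∀ k t, (1 - t) ^ k = 1 - k * t + e k t * t ^ 2 := by
    intro k t
    induction k with
    | zero => simp [e0]
    | succ k ih => rw [pow_succ, ih, es]; push_cast; ring
  have eb : ∀ k, ∀ t ∈ Set.Icc (0:ℝ) 1, 0 ≤ e k t ∧ e k t ≤ (k:ℝ)^2 := by
    intro k t ht
    induction k with
    | zero => simp [e0]
    | succ k ih =>
      have hk : (0:ℝ) ≤ k := k.cast_nonneg
      have h3 : 0 ≤ (1 - t) * e k t := mul_nonneg (by linarith [ht.2]) ih.1
      have h4 : 0 ≤ t * e k t := mul_nonneg ht.1 ih.1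
      rw [es]; push_cast
      constructor
      · linarith
      · nlinarith [ih.2]
  have hs : ∀ t ∈ Set.Icc (0:ℝ) 1, Summable fun k => e k t * g k := fun t ht =>
    Summable.of_nonneg_of_le (fun k => mul_nonneg (eb k t ht).1 (hg0 k))
      (fun k => mul_le_mul_of_nonneg_right (eb k t ht).2 (hg0 k)) h2
  refine ⟨fun t => ∑' k, e k t * g k, ?_, ?_⟩
  · have hl : ((∑' k : ℕ, (k : ℝ) ^ 2 * g k) - ∑' k : ℕ, (k : ℝ) * g k) / 2
        = ∑' k, e k 0 * g k := by
      rw [← h2.tsum_sub h1, ← tsum_div_const]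
      congr 1; ext k; rw [ev]; ring
    rw [hl]
    refine tendsto_tsum_of_dominated_convergence h2 ?_ ?_
    · intro k
      exact (((ec k).tendsto 0).mono_left nhdsWithin_le_nhds).mul_const _
    · filter_upwards [Ioc_mem_nhdsGT (zero_lt_one' ℝ)] with t ht k
      have h := eb k t ⟨ht.1.le, ht.2⟩
      rw [Real.norm_of_nonneg (mul_nonneg h.1 (hg0 k))]
      exact mul_le_mul_of_nonneg_right h.2 (hg0 k)
  · intro t ht
    refine ⟨tsum_nonneg fun k => mul_nonneg (eb k t ht).1 (hg0 k), 
      (hs t ht).tsum_le_tsum (fun k => mul_le_mul_of_nonneg_right (eb k t ht).2 (hg0 k)) h2, ?_⟩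
    have := (hg1.sub (h1.hasSum.mul_right t)).add ((hs t ht).hasSum.mul_right (t^2))
    rw [← this.tsum_eq]
    congr 1; ext k; rw [ep]; ring

open Filter Topology in
/-- Let `α ∈ (0,1)` and let `f` be a pmf on `ℕ` with finite mean and variance,
with pgf `Ψ`, and let `p` be the pmf with pgf `φ(z) = ∏_{i=0}^∞ Ψ(1 − α^i + α^i z)`, with
mean `μ⁽ᵖ⁾` and variance `σ⁽ᵖ⁾²`. Then `p` is underdispersed iff `f` is underdispersed:
`σ⁽ᵖ⁾² < μ⁽ᵖ⁾ ↔ σ⁽ᶠ⁾² < μ⁽ᶠ⁾`. -/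
theorem stmt_7 (α : ℝ) (hα : α ∈ Set.Ioo (0 : ℝ) 1)
    (f : ℕ → ℝ) (hf0 : ∀ k, 0 ≤ f k) (hf1 : HasSum f 1)
    (hmean : Summable fun k : ℕ => (k : ℝ) * f k)
    (hmom2 : Summable fun k : ℕ => (k : ℝ) ^ 2 * f k)
    (Ψ : ℝ → ℝ) (hΨ : ∀ z, Ψ z = ∑' k : ℕ, f k * z ^ k)
    (p : ℕ → ℝ) (hp0 : ∀ r, 0 ≤ p r) (hp1 : HasSum p 1)
    (hpmean : Summable fun k : ℕ => (k : ℝ) * p k)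
    (hpmom2 : Summable fun k : ℕ => (k : ℝ) ^ 2 * p k)
    (hppgf : ∀ z ∈ Set.Icc (0 : ℝ) 1,
      (∑' r : ℕ, p r * z ^ r) = ∏' i : ℕ, Ψ (1 - α ^ i + α ^ i * z)) :
    ((∑' k : ℕ, (k : ℝ) ^ 2 * p k) - (∑' k : ℕ, (k : ℝ) * p k) ^ 2
        < ∑' k : ℕ, (k : ℝ) * p k) ↔
      ((∑' k : ℕ, (k : ℝ) ^ 2 * f k) - (∑' k : ℕ, (k : ℝ) * f k) ^ 2
        < ∑' k : ℕ, (k : ℝ) * f k) := by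
  obtain ⟨R, hR, hRe⟩ := pgf_expand p hp0 hp1 hpmean hpmom2
  obtain ⟨S, hS, hSe⟩ := pgf_expand f hf0 hf1 hmean hmom2
  obtain ⟨a0, a1⟩ := hα
  have hF2 : 0 ≤ ∑' k : ℕ, (k : ℝ) ^ 2 * f k :=
    tsum_nonneg fun k => mul_nonneg (by positivity) (hf0 k)
  have hn0 : 0 ≤ ∑' k : ℕ, (k : ℝ) * f k :=
    tsum_nonneg fun k => mul_nonneg (by positivity) (hf0 k)
  generalize (∑' k : ℕ, (k : ℝ) ^ 2 * p k) = P2 at *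
  generalize (∑' k : ℕ, (k : ℝ) * p k) = m at *
  generalize (∑' k : ℕ, (k : ℝ) ^ 2 * f k) = F2 at *
  generalize (∑' k : ℕ, (k : ℝ) * f k) = n at *
  have hΨe : ∀ t ∈ Set.Icc (0 : ℝ) 1, Ψ (1 - t) = 1 - n * t + S t * t ^ 2 := fun t ht => by
    rw [hΨ]; exact (hSe t ht).2.2
  have hmem : ∀ t ∈ Set.Icc (0 : ℝ) 1, α * t ∈ Set.Icc (0 : ℝ) 1 := fun t ht =>
    ⟨mul_nonneg a0.le ht.1, mul_le_one₀ a1.le ht.1 ht.2⟩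
  have hmult : ∀ t ∈ Set.Icc (0 : ℝ) 1, Multipliable fun i : ℕ => Ψ (1 - α ^ i * t) := by
    intro t ht
    have hs : Summable fun i : ℕ => ‖Ψ (1 - α ^ i * t) - 1‖ := by
      refine Summable.of_nonneg_of_le (fun _ => norm_nonneg _) (fun i => ?_)
        ((summable_geometric_of_lt_one a0.le a1).mul_left (n + F2))
      have hai0 : 0 ≤ α ^ i := by positivity
      have hai1 : α ^ i ≤ 1 := pow_le_one₀ a0.le a1.le
      have hu : α ^ i * t ∈ Set.Icc (0 : ℝ) 1 :=
        ⟨mul_nonneg hai0 ht.1, mul_le_one₀ hai1 ht.1 ht.2⟩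
      have hle : α ^ i * t ≤ α ^ i := mul_le_of_le_one_right hai0 ht.2
      rw [hΨe _ hu]
      have hS := hSe _ hu
      generalize α ^ i * t = u at *
      have q1 : n * u ≤ n * α ^ i := mul_le_mul_of_nonneg_left hle hn0
      have q2 : 0 ≤ n * u := mul_nonneg hn0 hu.1
      have q3 : 0 ≤ S u * u ^ 2 := mul_nonneg hS.1 (sq_nonneg _)
      have q4 : S u * u ^ 2 ≤ F2 * α ^ i :=
        mul_le_mul hS.2.1 (by nlinarith [hu.1, hu.2]) (sq_nonneg _) hF2
      have q5 : 0 ≤ F2 * α ^ i := mul_nonneg hF2 hai0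
      rw [Real.norm_eq_abs, abs_le]
      constructor <;> nlinarith
    have := multipliable_one_add_of_summable hs
    simpa using this
  have hfun : ∀ t ∈ Set.Icc (0 : ℝ) 1, 1 - m * t + R t * t ^ 2 =
      (1 - n * t + S t * t ^ 2) * (1 - m * (α * t) + R (α * t) * (α * t) ^ 2) := by
    intro t ht
    have key : ∀ u ∈ Set.Icc (0 : ℝ) 1,
        1 - m * u + R u * u ^ 2 = ∏' i : ℕ, Ψ (1 - α ^ i * u) := by
      intro u hu
      rw [← (hRe u hu).2.2, hppgf (1 - u) ⟨by linarith [hu.2], by linarith [hu.1]⟩]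
      congr 1; ext i; congr 1; ring
    rw [key t ht, key _ (hmem t ht), ← hΨe t ht]
    have he : (fun i : ℕ => Ψ (1 - α ^ i * (α * t))) = fun i : ℕ => Ψ (1 - α ^ (i + 1) * t) := by
      ext i; congr 1; ring
    have h := hmult _ (hmem t ht)
    rw [he] at h
    rw [he, tprod_eq_zero_mul' (f := fun i : ℕ => Ψ (1 - α ^ i * t)) h]
    simp
  have hid : Tendsto (fun t : ℝ => t) (𝓝[>] 0) (𝓝 0) := nhdsWithin_le_nhds
  have hRa : Tendsto (fun t => R (α * t)) (𝓝[>] 0) (𝓝 ((P2 - m) / 2)) := by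
    refine hR.comp (tendsto_nhdsWithin_iff.2 ⟨by simpa using hid.const_mul α, ?_⟩)
    filter_upwards [self_mem_nhdsWithin] with t ht
    exact mul_pos a0 ht
  have hB := ((((hR.sub hS).sub_const (n * m * α)).sub (hRa.const_mul (α ^ 2))).add
    (hid.mul ((hRa.const_mul (n * α ^ 2)).add (hS.const_mul (m * α))))).sub
    ((hid.pow 2).mul ((hS.mul hRa).mul_const (α ^ 2)))
  have hI : Set.Ioc (0 : ℝ) 1 ∈ 𝓝[>] (0 : ℝ) := Ioc_mem_nhdsGT zero_lt_one
  have e1 : m - n - m * α = 0 := by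
    have h := hid.mul hB
    rw [zero_mul] at h
    refine tendsto_nhds_unique (tendsto_const_nhds.congr' ?_) h
    filter_upwards [hI] with t ht
    have := hfun t ⟨ht.1.le, ht.2⟩
    apply mul_left_cancel₀ ht.1.ne'
    linear_combination -this
  have e2 := tendsto_nhds_unique (tendsto_const_nhds.congr' (f₁ := fun _ => (0 : ℝ)) (by
    filter_upwards [hI] with t ht
    have := hfun t ⟨ht.1.le, ht.2⟩
    apply mul_left_cancel₀ (pow_ne_zero 2 ht.1.ne')
    linear_combination -this - t * e1)) hB
  have e3 : (1 - α ^ 2) * (P2 - m ^ 2 - m) = F2 - n ^ 2 - n := by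
    have hn : n = m - m * α := by linarith
    subst hn
    linear_combination -2 * e2
  have hpos : 0 < 1 - α ^ 2 := by nlinarith
  constructor
  · intro h
    have := mul_neg_of_pos_of_neg hpos (show P2 - m ^ 2 - m < 0 by linarith)
    linarith
  · intro h
    by_contra hc
    have := mul_nonneg hpos.le (show 0 ≤ P2 - m ^ 2 - m by linarith)
    linarith
end

section
/- Let α, p ∈ (0,1) and let (p_r)_{r≥0} be the pmf given by p_r = ∑_{k=r}^∞ (−1)^{k−r} C(k,r) · p^k α^{k(k−1)/2} / ∏_{l=1}^{k} (1 − α^l) (the marginal pmf of the stationary INAR(1) process with Bernoulli(p) innovations). Then for every r ≥ 1 the tail probabilities satisfy ∑_{j=r}^∞ p_j = ∑_{k=r}^∞ (−1)^{k−r} C(k−1, r−1) · p^k α^{k(k−1)/2} / ∏_{l=1}^{k} (1 − α^l). -/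
lemma aux_diag (F : ℕ × ℕ → ℝ)
    (h : Summable fun n => ∑ x ∈ Finset.HasAntidiagonal.antidiagonal n, |F x|) :
    ∑' j, ∑' m, F (j, m) = ∑' n, ∑ x ∈ Finset.HasAntidiagonal.antidiagonal n, F x := by
  have hs : Summable F := by
    rw [← summable_abs_iff, ← Finset.HasAntidiagonal.sigmaAntidiagonalEquivProd.summable_iff]
    refine (summable_sigma_of_nonneg (fun _ => abs_nonneg _)).mpr ⟨fun n => Summable.of_finite, h.congr fun n => ?_⟩
    rw [tsum_fintype, ← Finset.sum_coe_sort]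
    rfl
  rw [← hs.tsum_prod' hs.prod_factor,
    ← Finset.HasAntidiagonal.sigmaAntidiagonalEquivProd.tsum_eq]
  refine (Summable.tsum_sigma' (fun n => Summable.of_finite)
      (Finset.HasAntidiagonal.sigmaAntidiagonalEquivProd.summable_iff.mpr hs)).trans ?_
  refine tsum_congr fun n => ?_
  rw [tsum_fintype, ← Finset.sum_coe_sort (Finset.HasAntidiagonal.antidiagonal n)]
  rfl

lemma aux_core (c : ℕ → ℝ) (hc : Summable fun n => (2 : ℝ) ^ n * |c n|) (s : ℕ) :
    ∑' j : ℕ, ∑' m : ℕ, (-1 : ℝ) ^ m * ((m + (j + (s + 1))).choose (j + (s + 1)) : ℝ)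
        * c (m + (j + (s + 1)))
      = ∑' m : ℕ, (-1 : ℝ) ^ m * ((m + s).choose s : ℝ) * c (m + (s + 1)) := by
  have key : ∀ n : ℕ, ∀ x ∈ Finset.HasAntidiagonal.antidiagonal n,
      x.2 + (x.1 + (s + 1)) = n + (s + 1) ∧
      (x.2 + (x.1 + (s + 1))).choose (x.1 + (s + 1)) = (n + s + 1).choose x.2 := by
    intro n x hx
    rw [Finset.HasAntidiagonal.mem_antidiagonal] at hx
    refine ⟨by omega, ?_⟩
    rw [Nat.choose_symm_add.symm]
    congr 1
    omega
  rw [aux_diag (fun x => (-1 : ℝ) ^ x.2 *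
      ((x.2 + (x.1 + (s + 1))).choose (x.1 + (s + 1)) : ℝ) * c (x.2 + (x.1 + (s + 1))))]
  · refine tsum_congr fun n => ?_
    have h1 := Int.alternating_sum_range_choose_eq_choose (n := n + s) (m := n)
    have h2 : (∑ k ∈ Finset.range (n + 1), ((-1 : ℝ) ^ k * ((n + s + 1).choose k : ℝ)))
        = (-1) ^ n * ((n + s).choose n : ℝ) := by exact_mod_cast h1
    rw [← Nat.choose_symm_add, ← h2, Finset.sum_mul,
      ← Finset.Nat.sum_antidiagonal_swap, Finset.Nat.sum_antidiagonal_eq_sum_range_succ_mk]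
    refine Finset.sum_congr rfl fun k hk => ?_
    have hk' : (n - k, k) ∈ Finset.HasAntidiagonal.antidiagonal n := by
      have := Finset.mem_range.mp hk
      simp; omega
    obtain ⟨e1, e2⟩ := key n _ hk'
    simp only [Prod.swap] at *
    rw [e2, e1]
  · have hc' := (summable_nat_add_iff (s + 1)).mpr hc
    refine Summable.of_nonneg_of_le
      (fun n => Finset.sum_nonneg fun _ _ => abs_nonneg _) (fun n => ?_) hc'
    have : ∀ x ∈ Finset.HasAntidiagonal.antidiagonal n, |(-1 : ℝ) ^ x.2 *
      ((x.2 + (x.1 + (s + 1))).choose (x.1 + (s + 1)) : ℝ) * c (x.2 + (x.1 + (s + 1)))|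
       = ((n + s + 1).choose x.2 : ℝ) * |c (n + (s + 1))| := by
      intro x hx
      obtain ⟨e1, e2⟩ := key n x hx
      rw [e2, e1]
      simp [abs_mul]
    rw [Finset.sum_congr rfl this, ← Finset.sum_mul]
    refine mul_le_mul_of_nonneg_right ?_ (abs_nonneg _)
    rw [← Finset.Nat.sum_antidiagonal_swap, Finset.Nat.sum_antidiagonal_eq_sum_range_succ_mk]
    simp only [Prod.swap]
    have h3 := Nat.sum_range_choose (n + s + 1)
    have h4 : ∑ k ∈ Finset.range (n + 1), (n + s + 1).choose k ≤ 2 ^ (n + (s + 1)) := by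
      rw [← add_assoc, ← h3]
      exact Finset.sum_le_sum_of_subset (Finset.range_mono (by omega))
    exact_mod_cast h4

lemma aux_summable (α p : ℝ) (hα : α ∈ Set.Ioo (0 : ℝ) 1) (hp : p ∈ Set.Ioo (0 : ℝ) 1) :
    Summable fun n : ℕ => (2 : ℝ) ^ n * |p ^ n * α ^ (n * (n - 1) / 2)
        / ∏ l ∈ Finset.range n, (1 - α ^ (l + 1))| := by
  obtain ⟨h0, h1⟩ := hα
  obtain ⟨p0, p1⟩ := hp
  have hpos : ∀ l : ℕ, 0 < 1 - α ^ (l + 1) := fun l =>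
    sub_pos.mpr (pow_lt_one₀ h0.le h1 (by omega))
  have hP : ∀ n : ℕ, 0 < ∏ l ∈ Finset.range n, (1 - α ^ (l + 1)) := fun n =>
    Finset.prod_pos fun l _ => hpos l
  have hcp : ∀ n : ℕ, 0 < p ^ n * α ^ (n * (n - 1) / 2)
        / ∏ l ∈ Finset.range n, (1 - α ^ (l + 1)) := fun n =>
    div_pos (by positivity) (hP n)
  have hpow := tendsto_pow_atTop_nhds_zero_of_lt_one h0.le h1
  refine summable_of_ratio_test_tendsto_lt_one (l := 0) (by norm_num)
    (Filter.Eventually.of_forall fun n => ?_) ?_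
  · have := hcp n
    positivity
  · have hlim : Filter.Tendsto (fun n : ℕ => 2 * p * α ^ n / (1 - α ^ (n + 1)))
        Filter.atTop (nhds 0) := by
      have a := (hpow.const_mul (2 * p)).div
        (((Filter.tendsto_add_atTop_iff_nat 1).mpr hpow).const_sub 1) (by norm_num)
      rw [mul_zero, zero_div] at a
      exact a
    refine hlim.congr fun n => ?_
    rw [abs_of_pos (hcp n), abs_of_pos (hcp (n + 1)), Finset.prod_range_succ,
      ]
    have ht : (n + 1) * (n + 1 - 1) / 2 = n * (n - 1) / 2 + n := Nat.triangle_succ n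
    rw [ht, pow_add α (n * (n - 1) / 2) n, pow_succ p, pow_succ 2]
    have := (hP n).ne'
    have := (hpos n).ne'
    have := (hcp n).ne'
    have hn1 : 0 < (2 : ℝ) ^ n * (p ^ n * α ^ (n * (n - 1) / 2)
        / ∏ l ∈ Finset.range n, (1 - α ^ (l + 1))) := mul_pos (by positivity) (hcp n)
    have hn2 : 0 < (2 : ℝ) ^ n * 2 * (p ^ n * p * (α ^ (n * (n - 1) / 2) * α ^ n)
        / ((∏ l ∈ Finset.range n, (1 - α ^ (l + 1))) * (1 - α ^ (n + 1)))) :=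
      mul_pos (by positivity) (div_pos (by positivity) (mul_pos (hP n) (hpos n)))
    rw [Real.norm_of_nonneg hn1.le, Real.norm_of_nonneg hn2.le]
    field_simp


/-- Let `α, p ∈ (0,1)` and let `(p_r)` be the marginal pmf of the stationary
INAR(1) process with Bernoulli(p) innovations,
`p_r = ∑_{k=r}^∞ (−1)^{k−r} C(k,r) p^k α^{k(k−1)/2} / ∏_{l=1}^{k} (1 − α^l)`.
Then for every `r ≥ 1`,
`∑_{j=r}^∞ p_j = ∑_{k=r}^∞ (−1)^{k−r} C(k−1, r−1) p^k α^{k(k−1)/2} / ∏_{l=1}^{k} (1 − α^l)`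
(sums over `k = m + r`, `m ∈ ℕ`). -/
theorem stmt_11 (α p : ℝ) (hα : α ∈ Set.Ioo (0 : ℝ) 1) (hp : p ∈ Set.Ioo (0 : ℝ) 1)
    (pr : ℕ → ℝ)
    (hpr : ∀ r, pr r = ∑' m : ℕ,
      (-1 : ℝ) ^ m * ((m + r).choose r : ℝ) * p ^ (m + r)
        * α ^ ((m + r) * (m + r - 1) / 2)
        / ∏ l ∈ Finset.range (m + r), (1 - α ^ (l + 1))) :
    ∀ r : ℕ, 1 ≤ r →
      (∑' j : ℕ, pr (j + r)) = ∑' m : ℕ,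
        (-1 : ℝ) ^ m * ((m + r - 1).choose (r - 1) : ℝ) * p ^ (m + r)
          * α ^ ((m + r) * (m + r - 1) / 2)
          / ∏ l ∈ Finset.range (m + r), (1 - α ^ (l + 1)) := by
  intro r hr
  obtain ⟨s, rfl⟩ : ∃ s, r = s + 1 := ⟨r - 1, by omega⟩
  have h := aux_core _ (aux_summable α p hα hp) s
  simp only [hpr]
  convert h using 1
  · refine tsum_congr fun j => tsum_congr fun m => ?_
    ring
  · refine tsum_congr fun m => ?_
    have e : m + (s + 1) - 1 = m + s := by omega
    simp only [e, Nat.add_sub_cancel]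
    ring
end
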